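/- arXiv:2107.03750 — 2 statements merged into one kernel-verified Lean document; each statement's English description precedes it below -/
import Mathlib

section
/- Let G be a connected finite simple graph that is bull-free and diamond-free with ω = ω(G) > 2, let K be a maximum clique of G, and suppose G is not isomorphic to a subgraph of K_ω □ K_2 (i.e., there is no injective graph homomorphism from G into K_ω □ K_2). Then for every i > 1, every connected component of the subgraph of G induced by N_i(K) is either a complete graph or triangle-free. -/
open SimpleGraph

/-- `G` is `H`-free: no induced subgraph of `G` is isomorphic to `H`. -/
def IsIndFree {V W : Type*} (G : SimpleGraph V) (H : SimpleGraph W) : Prop :=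
  ∀ s : Set V, ¬ Nonempty (H ≃g G.induce s)

/-- The bull: a triangle with two pendant edges at distinct vertices. -/
def bull : SimpleGraph (Fin 5) :=
  SimpleGraph.fromEdgeSet {s(0,1), s(1,2), s(0,2), s(1,3), s(2,4)}

/-- The diamond: `K₄` minus an edge. -/
def diamond : SimpleGraph (Fin 4) :=
  SimpleGraph.fromEdgeSet {s(0,2), s(0,3), s(1,2), s(1,3), s(2,3)}

/-- Distance from a vertex `x` to a set `K` of vertices. -/
noncomputable def distToSet {V : Type*} (G : SimpleGraph V) (x : V) (K : Set V) : ℕ :=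
  sInf ((G.dist x) '' K)

/-- `N_i(K)`: the set of vertices at distance exactly `i` from `K`. -/
def levelSet {V : Type*} (G : SimpleGraph V) (K : Set V) (i : ℕ) : Set V :=
  {x | distToSet G x K = i}

/-- An `H`-free graph admits no injection from `H` preserving adjacency and non-adjacency. -/
theorem IsIndFree.not_injective {V W : Type*} {G : SimpleGraph V} {H : SimpleGraph W}
    (h : IsIndFree G H) {f : W → V} (hf : ∀ a b, G.Adj (f a) (f b) ↔ H.Adj a b) :
    ¬ f.Injective := by
  intro hinj
  refine h (Set.range f) ⟨⟨Equiv.ofInjective f hinj, ?_⟩⟩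
  intro a b
  simp [hf]

/-- In a diamond-free graph, two distinct common neighbours of the ends of an edge are adjacent. -/
theorem IsIndFree.adj_of_diamond {V : Type*} {G : SimpleGraph V} (h : IsIndFree G diamond)
    {a b c d : V} (hab : a ≠ b) (hac : G.Adj a c) (had : G.Adj a d) (hbc : G.Adj b c)
    (hbd : G.Adj b d) (hcd : G.Adj c d) : G.Adj a b := by
  by_contra hn
  have hn' : ¬ G.Adj b a := fun e => hn e.symm
  refine h.not_injective (f := ![a, b, c, d]) ?_ ?_
  · intro i j
    fin_cases i <;> fin_cases j <;>
      simp [diamond, hn, hn', hac, had, hbc, hbd, hcd,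
        hac.symm, had.symm, hbc.symm, hbd.symm, hcd.symm]
  · intro i j
    fin_cases i <;> fin_cases j <;>
      simp [hab, hab.symm, hac.ne, had.ne, hbc.ne, hbd.ne, hcd.ne,
        hac.ne', had.ne', hbc.ne', hbd.ne', hcd.ne']

/-- In a bull-free graph, private neighbours of two vertices of a triangle are adjacent. -/
theorem IsIndFree.adj_of_bull {V : Type*} {G : SimpleGraph V} (h : IsIndFree G bull)
    {a b c x y : V} (hab : G.Adj a b) (hac : G.Adj a c) (hbc : G.Adj b c)
    (hax : G.Adj a x) (hby : G.Adj b y) (hbx : ¬ G.Adj b x) (hcx : ¬ G.Adj c x)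
    (hay : ¬ G.Adj a y) (hcy : ¬ G.Adj c y) : G.Adj x y := by
  by_contra hn
  have hn' : ¬ G.Adj y x := fun e => hn e.symm
  have hbx' : ¬ G.Adj x b := fun e => hbx e.symm
  have hcx' : ¬ G.Adj x c := fun e => hcx e.symm
  have hay' : ¬ G.Adj y a := fun e => hay e.symm
  have hcy' : ¬ G.Adj y c := fun e => hcy e.symm
  have n1 : b ≠ x := by rintro rfl; exact hcx hbc.symm
  have n2 : c ≠ x := by rintro rfl; exact hbx hbc
  have n3 : a ≠ y := by rintro rfl; exact hcy hac.symm
  have n4 : c ≠ y := by rintro rfl; exact hay hac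
  have n5 : x ≠ y := by rintro rfl; exact hbx hby
  refine h.not_injective (f := ![c, a, b, x, y]) ?_ ?_
  · intro i j
    fin_cases i <;> fin_cases j <;>
      simp [bull, hn, hn', hbx, hbx', hcx, hcx', hay, hay', hcy, hcy', hab, hac, hbc, hax, hby,
        hab.symm, hac.symm, hbc.symm, hax.symm, hby.symm]
  · intro i j
    fin_cases i <;> fin_cases j <;>
      simp [hab.ne, hac.ne, hbc.ne, hax.ne, hby.ne, hab.ne', hac.ne', hbc.ne', hax.ne', hby.ne',
        n1, n2, n3, n4, n5, n1.symm, n2.symm, n3.symm, n4.symm, n5.symm]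

theorem distToSet_le_of_adj {V : Type*} {G : SimpleGraph V} (hconn : G.Connected) {K : Set V}
    {u v : V} (h : G.Adj u v) : distToSet G u K ≤ distToSet G v K + 1 := by
  rcases K.eq_empty_or_nonempty with rfl | hK
  · simp [distToSet]
  · obtain ⟨k, hk, hkv⟩ := Nat.sInf_mem (hK.image (G.dist v))
    have h1 : distToSet G u K ≤ G.dist u k := Nat.sInf_le ⟨k, hk, rfl⟩
    have h2 : G.dist u k ≤ G.dist u v + G.dist v k := hconn.dist_triangle
    rw [dist_eq_one_iff_adj.mpr h] at h2
    have h3 : G.dist v k = distToSet G v K := hkv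
    omega

theorem exists_adj_distToSet_add_one {V : Type*} {G : SimpleGraph V} (hconn : G.Connected)
    {K : Set V} {x : V} (h : 0 < distToSet G x K) :
    ∃ p, G.Adj x p ∧ distToSet G p K + 1 = distToSet G x K := by
  have hne : (G.dist x '' K).Nonempty := by
    by_contra hn
    rw [Set.not_nonempty_iff_eq_empty] at hn
    simp [distToSet, hn] at h
  obtain ⟨k, hk, hkx⟩ := Nat.sInf_mem hne
  have hkx : G.dist x k = distToSet G x K := hkx
  obtain ⟨w, hw⟩ := hconn.exists_walk_length_eq_dist x k
  cases w with
  | nil => simp at hkx; omega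
  | @cons _ p _ hxp w =>
    refine ⟨p, hxp, ?_⟩
    have h1 : distToSet G p K ≤ G.dist p k := Nat.sInf_le ⟨k, hk, rfl⟩
    have h2 : G.dist p k ≤ w.length := dist_le w
    have h3 := distToSet_le_of_adj hconn (K := K) hxp
    rw [Walk.length_cons] at hw
    omega

/-- In a bull-free and diamond-free graph, a vertex of a level at distance at least two from `K`
which is adjacent to one vertex of a triangle in this level is adjacent to all of them. -/
theorem adj_of_triangle_of_distToSet_eq {V : Type*} {G : SimpleGraph V} (hconn : G.Connected)
    (hGb : IsIndFree G bull) (hGd : IsIndFree G diamond) {K : Set V} {i : ℕ} (hi : 1 < i)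
    {a b c y : V} (ha : distToSet G a K = i) (hb : distToSet G b K = i)
    (hc : distToSet G c K = i) (hy : distToSet G y K = i)
    (hab : G.Adj a b) (hac : G.Adj a c) (hbc : G.Adj b c) (hay : G.Adj a y) (hyb : y ≠ b) :
    G.Adj y b := by
  by_contra hn
  have hyc : ¬ G.Adj y c := fun e => hn <| hGd.adj_of_diamond hyb hay.symm e hab.symm hbc hac
  have far : ∀ u v, distToSet G u K = i → distToSet G v K + 2 ≤ i → ¬ G.Adj u v := by
    intro u v hu hv e
    have := distToSet_le_of_adj hconn (K := K) e
    omega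
  have common : ∀ p u, distToSet G u K = i → G.Adj a u → ¬ G.Adj y u → y ≠ u →
      distToSet G p K + 1 = i → G.Adj a p → G.Adj u p → False := by
    intro p u hu hau hyu hne hp hap hup
    have hyp : ¬ G.Adj y p := fun e =>
      hyu <| hGd.adj_of_diamond hne hay.symm e hau.symm hup hap
    obtain ⟨q, hpq, hq⟩ := exists_adj_distToSet_add_one hconn (x := p) (K := K) (by omega)
    exact far y q hy (by omega) <| hGb.adj_of_bull hap hau hup.symm hay hpq
      (fun e => hyp e.symm) (fun e => hyu e.symm) (far a q ha (by omega)) (far u q hu (by omega))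
  have hyc' : y ≠ c := by rintro rfl; exact hn hbc.symm
  obtain ⟨p, hap, hp⟩ := exists_adj_distToSet_add_one hconn (x := a) (K := K) (by omega)
  obtain ⟨q, hbq, hq⟩ := exists_adj_distToSet_add_one hconn (x := b) (K := K) (by omega)
  obtain ⟨r, hcr, hr⟩ := exists_adj_distToSet_add_one hconn (x := c) (K := K) (by omega)
  have hbp : ¬ G.Adj b p := common p b hb hab hn hyb (by omega) hap
  have hcp : ¬ G.Adj c p := common p c hc hac hyc hyc' (by omega) hap
  have haq : ¬ G.Adj a q := fun e => common q b hb hab hn hyb (by omega) e hbq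
  have har : ¬ G.Adj a r := fun e => common r c hc hac hyc hyc' (by omega) e hcr
  have hcq : ¬ G.Adj c q := fun e => haq <|
    hGd.adj_of_diamond (by rintro rfl; omega) hab hac hbq.symm e.symm hbc
  have hbr : ¬ G.Adj b r := fun e => har <|
    hGd.adj_of_diamond (by rintro rfl; omega) hab hac e.symm hcr.symm hbc
  have hpq : G.Adj p q := hGb.adj_of_bull hab hac hbc hap hbq hbp hcp haq hcq
  have hpr : G.Adj p r := hGb.adj_of_bull hac hab hbc.symm hap hcr hcp hbp har hbr
  have hqr : G.Adj q r := hGb.adj_of_bull hbc hab.symm hac.symm hbq hcr hcq haq hbr har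
  have hyq : G.Adj y q := hGb.adj_of_bull hab hac hbc hay hbq
    (fun e => hn e.symm) (fun e => hyc e.symm) haq hcq
  have hyr : G.Adj y r := hGb.adj_of_bull hac hab hbc.symm hay hcr
    (fun e => hyc e.symm) (fun e => hn e.symm) har hbr
  have hyp : G.Adj y p :=
    hGd.adj_of_diamond (by rintro rfl; omega) hyq hyr hpq hpr hqr
  exact haq <| hGd.adj_of_diamond (by rintro rfl; omega) hay hap hyq.symm hpq.symm hyp

/-- If every neighbour of a vertex of a triangle is adjacent to the whole triangle, then the
component of a triangle is complete. -/
theorem eq_or_adj_of_reachable_of_triangle {V : Type*} {G : SimpleGraph V}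
    (h : ∀ a b c y, G.Adj a b → G.Adj a c → G.Adj b c → G.Adj a y → y ≠ b → G.Adj y b)
    {a b c : V} (hab : G.Adj a b) (hac : G.Adj a c) (hbc : G.Adj b c) {x y : V}
    (hx : G.Reachable a x) (hy : G.Reachable a y) : x = y ∨ G.Adj x y := by
  have triangle : ∀ v, G.Adj a v → ∃ w, G.Adj a w ∧ G.Adj v w := by
    intro v hv
    by_cases hvb : v = b
    · exact ⟨c, hac, hvb ▸ hbc⟩
    · exact ⟨b, hab, h a b c v hab hac hbc hv hvb⟩
  have near : ∀ v, G.Reachable a v → v = a ∨ G.Adj a v := by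
    intro v hv
    rw [reachable_iff_reflTransGen] at hv
    induction hv with
    | refl => exact Or.inl rfl
    | @tail u v _ huv ih =>
      rcases ih with rfl | hau
      · exact Or.inr huv
      · by_cases hva : v = a
        · exact Or.inl hva
        · obtain ⟨w, haw, huw⟩ := triangle u hau
          exact Or.inr (h u a w v hau.symm huw haw huv hva).symm
  rcases near x hx with rfl | hax
  · exact (near y hy).imp Eq.symm id
  · rcases near y hy with rfl | hay
    · exact Or.inr hax.symm
    · by_cases hxy : x = y
      · exact Or.inl hxy
      · obtain ⟨w, haw, hyw⟩ := triangle y hay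
        exact Or.inr (h a y w x hay haw hyw hax hxy)

theorem statement_15 {V : Type*} [Fintype V] [DecidableEq V] (G : SimpleGraph V)
    (hconn : G.Connected) (hGb : IsIndFree G bull) (hGd : IsIndFree G diamond)
    (hw : 2 < G.cliqueNum) (K : Finset V) (hK : G.IsMaximumClique K)
    (hsub : ¬ ∃ f : G →g (completeGraph (Fin G.cliqueNum) □ completeGraph (Fin 2)),
      Function.Injective f) :
    ∀ i : ℕ, 1 < i →
      ∀ c : (G.induce (levelSet G (↑K) i)).ConnectedComponent,
        (∀ x y : ↥(levelSet G (↑K) i),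
            (G.induce (levelSet G (↑K) i)).connectedComponentMk x = c →
            (G.induce (levelSet G (↑K) i)).connectedComponentMk y = c →
            x = y ∨ (G.induce (levelSet G (↑K) i)).Adj x y) ∨
        (∀ x y z : ↥(levelSet G (↑K) i),
            (G.induce (levelSet G (↑K) i)).connectedComponentMk x = c →
            (G.induce (levelSet G (↑K) i)).connectedComponentMk y = c →
            (G.induce (levelSet G (↑K) i)).connectedComponentMk z = c →
            ¬ ((G.induce (levelSet G (↑K) i)).Adj x y ∧
               (G.induce (levelSet G (↑K) i)).Adj y z ∧
               (G.induce (levelSet G (↑K) i)).Adj x z)) := by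
  intro i hi c
  refine or_iff_not_imp_right.mpr fun hT x y hx hy => ?_
  push Not at hT
  obtain ⟨a, b, d, rfl, -, -, hab, hbd, had⟩ := hT
  refine eq_or_adj_of_reachable_of_triangle (fun a b c y hab hac hbc hay hyb => ?_) hab had hbd
    (ConnectedComponent.exact hx).symm (ConnectedComponent.exact hy).symm
  exact adj_of_triangle_of_distToSet_eq hconn hGb hGd hi a.2 b.2 c.2 y.2 hab hac hbc hay
    (fun e => hyb (Subtype.ext e))
end

section
/- Let G be a connected finite simple graph that is bull-free and diamond-free with ω = ω(G) > 2, let K be a maximum clique of G, and suppose G is not isomorphic to a subgraph of K_ω □ K_2 (i.e., there is no injective graph homomorphism from G into K_ω □ K_2). Then for every i ≥ 2, the subgraph of G induced by N_i(K) is paw-free. -/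
open SimpleGraph

/-- The paw: a triangle with one pendant edge. -/
def paw : SimpleGraph (Fin 4) :=
  SimpleGraph.fromEdgeSet {s(0,1), s(1,2), s(0,2), s(2,3)}

/-- An embedding of `H` into `G` exhibits `H` as an induced subgraph. -/
theorem IsIndFree.false_of_embedding {V W : Type*} {G : SimpleGraph V} {H : SimpleGraph W}
    (h : IsIndFree G H) (f : H ↪g G) : False :=
  h (Set.range f) ⟨f.isoInduceRange⟩

/-- In a diamond-free graph, two distinct common neighbours of adjacent vertices are adjacent. -/
theorem IsIndFree.adj_of_diamond_s19 {V : Type*} {G : SimpleGraph V} (h : IsIndFree G diamond)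
    {u v x y : V} (hxy : x ≠ y) (huv : G.Adj u v) (hxu : G.Adj x u) (hxv : G.Adj x v)
    (hyu : G.Adj y u) (hyv : G.Adj y v) : G.Adj x y := by
  by_contra hn
  refine h.false_of_embedding ⟨⟨![x, y, u, v], ?_⟩, ?_⟩
  · intro i j hij
    by_contra hne
    fin_cases i <;> fin_cases j <;> simp at hij hne <;> subst_vars <;> simp_all [G.adj_comm]
  · intro i j
    change G.Adj (![x, y, u, v] i) (![x, y, u, v] j) ↔ diamond.Adj i j
    fin_cases i <;> fin_cases j <;> simp [diamond] <;> grind [G.adj_comm]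

/-- In a bull-free graph, private neighbours of two vertices of a triangle are adjacent. -/
theorem IsIndFree.adj_of_bull_s19 {V : Type*} {G : SimpleGraph V} (h : IsIndFree G bull)
    {p q r x y : V} (hpq : G.Adj p q) (hpr : G.Adj p r) (hqr : G.Adj q r)
    (hxp : G.Adj x p) (hxq : ¬ G.Adj x q) (hxr : ¬ G.Adj x r)
    (hyq : G.Adj y q) (hyp : ¬ G.Adj y p) (hyr : ¬ G.Adj y r) : G.Adj x y := by
  by_contra hn
  refine h.false_of_embedding ⟨⟨![r, p, q, x, y], ?_⟩, ?_⟩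
  · intro i j hij
    by_contra hne
    fin_cases i <;> fin_cases j <;> simp at hij hne <;> subst_vars <;> simp_all [G.adj_comm]
  · intro i j
    change G.Adj (![r, p, q, x, y] i) (![r, p, q, x, y] j) ↔ bull.Adj i j
    fin_cases i <;> fin_cases j <;> simp [bull] <;> grind [G.adj_comm]

theorem exists_dist_eq_distToSet {V : Type*} (G : SimpleGraph V) {K : Set V} (hK : K.Nonempty)
    (x : V) : ∃ k ∈ K, G.dist x k = distToSet G x K :=
  Nat.sInf_mem (hK.image (G.dist x))

theorem distToSet_le {V : Type*} (G : SimpleGraph V) {K : Set V} (x : V) {k : V} (hk : k ∈ K) :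
    distToSet G x K ≤ G.dist x k :=
  Nat.sInf_le ⟨k, hk, rfl⟩

theorem SimpleGraph.Adj.distToSet_le_succ {V : Type*} {G : SimpleGraph V} (hG : G.Connected)
    {K : Set V} (hK : K.Nonempty) {x y : V} (hxy : G.Adj x y) :
    distToSet G x K ≤ distToSet G y K + 1 := by
  obtain ⟨k, hk, hd⟩ := exists_dist_eq_distToSet G hK y
  have := distToSet_le G x hk
  have := hG.dist_triangle (u := x) (v := y) (w := k)
  have := dist_eq_one_iff_adj.2 hxy
  lia

/-- Every vertex at positive distance from `K` has a neighbour one step closer. -/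
theorem exists_adj_distToSet_eq {V : Type*} {G : SimpleGraph V} (hG : G.Connected)
    {K : Set V} (hK : K.Nonempty) {x : V} {n : ℕ} (hx : distToSet G x K = n + 1) :
    ∃ y, G.Adj y x ∧ distToSet G y K = n := by
  obtain ⟨k, hk, hd⟩ := exists_dist_eq_distToSet G hK x
  obtain ⟨w, hw⟩ := hG.exists_walk_length_eq_dist x k
  cases w with
  | nil => simp at hd; lia
  | cons h p =>
    rename_i y
    refine ⟨y, h.symm, ?_⟩
    have := h.distToSet_le_succ hG hK
    have := distToSet_le G y hk
    have := dist_le p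
    rw [Walk.length_cons] at hw
    lia

theorem statement_19 {V : Type*} [Fintype V] [DecidableEq V] (G : SimpleGraph V)
    (hconn : G.Connected) (hGb : IsIndFree G bull) (hGd : IsIndFree G diamond)
    (hw : 2 < G.cliqueNum) (K : Finset V) (hK : G.IsMaximumClique K)
    (hsub : ¬ ∃ f : G →g (completeGraph (Fin G.cliqueNum) □ completeGraph (Fin 2)),
      Function.Injective f) :
    ∀ i : ℕ, 2 ≤ i → IsIndFree (G.induce (levelSet G (↑K) i)) paw := by
  intro i hi s
  rintro ⟨e⟩
  have hKne : (K : Set V).Nonempty := by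
    rw [Finset.coe_nonempty, ← Finset.card_pos, maximumClique_card_eq_cliqueNum K hK]
    lia
  obtain ⟨n, rfl⟩ : ∃ n, i = n + 2 := ⟨i - 2, by lia⟩
  set f : Fin 4 → V := fun j => (e j).1.1
  have hlev (j : Fin 4) : distToSet G (f j) K = n + 2 := (e j).1.2
  have hadj (j k : Fin 4) : G.Adj (f j) (f k) ↔ paw.Adj j k := e.map_adj_iff
  have hab : G.Adj (f 0) (f 1) := (hadj _ _).2 (by simp [paw])
  have hbc : G.Adj (f 1) (f 2) := (hadj _ _).2 (by simp [paw])
  have hac : G.Adj (f 0) (f 2) := (hadj _ _).2 (by simp [paw])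
  have hdc : G.Adj (f 3) (f 2) := (hadj _ _).2 (by simp [paw])
  have hda : ¬ G.Adj (f 3) (f 0) := fun h => by simpa [paw] using (hadj _ _).1 h
  have hdb : ¬ G.Adj (f 3) (f 1) := fun h => by simpa [paw] using (hadj _ _).1 h
  have ha := hlev 0
  have hb := hlev 1
  have hc := hlev 2
  have hd := hlev 3
  generalize f 0 = a at *
  generalize f 1 = b at *
  generalize f 2 = c at *
  generalize f 3 = d at *
  clear hadj
  have far {x y : V} (hx : distToSet G x K = n) (hy : distToSet G y K = n + 2) :
      ¬ G.Adj x y := fun h => by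
    have := h.symm.distToSet_le_succ hconn hKne
    lia
  have ne_lev {x y : V} (hx : distToSet G x K = n + 1) (hy : distToSet G y K = n + 2) :
      x ≠ y := by
    rintro rfl
    lia
  -- no vertex of the previous level is adjacent to both `a` and `c`
  have not_ac {q : V} (hq : distToSet G q K = n + 1) (hqa : G.Adj q a) : ¬ G.Adj q c := by
    intro hqc
    obtain ⟨r, hrq, hr⟩ := exists_adj_distToSet_eq hconn hKne hq
    have hdq : ¬ G.Adj d q := fun hdq =>
      hda (hGd.adj_of_diamond_s19 (by rintro rfl; exact hdb hab) hqc hdq hdc hqa.symm hac)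
    exact far hr hd (hGb.adj_of_bull_s19 hqc hqa hac.symm hrq (far hr hc) (far hr ha) hdc hdq hda)
  have not_ab {q : V} (hq : distToSet G q K = n + 1) (hqa : G.Adj q a) : ¬ G.Adj q b :=
    fun hqb => not_ac hq hqa
      (hGd.adj_of_diamond_s19 (ne_lev hq hc) hab hqa hqb hac.symm hbc.symm)
  have not_bc {q : V} (hq : distToSet G q K = n + 1) (hqb : G.Adj q b) : ¬ G.Adj q c :=
    fun hqc => not_ab hq
      (hGd.adj_of_diamond_s19 (ne_lev hq ha) hbc hqb hqc hab hac) hqb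
  obtain ⟨a', haa, ha'⟩ := exists_adj_distToSet_eq hconn hKne ha
  obtain ⟨b', hbb, hb'⟩ := exists_adj_distToSet_eq hconn hKne hb
  obtain ⟨c', hcc, hc'⟩ := exists_adj_distToSet_eq hconn hKne hc
  have hab' := not_ab ha' haa
  have hac' := not_ac ha' haa
  have hba' : ¬ G.Adj b' a := fun h => not_ab hb' h hbb
  have hbc' := not_bc hb' hbb
  have hca' : ¬ G.Adj c' a := fun h => not_ac hc' h hcc
  have hcb' : ¬ G.Adj c' b := fun h => not_bc hc' h hcc
  have had := hGb.adj_of_bull_s19 hac hab hbc.symm haa hac' hab' hdc hda hdb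
  have hbd := hGb.adj_of_bull_s19 hbc hab.symm hac.symm hbb hbc' hba' hdc hdb hda
  have habp := hGb.adj_of_bull_s19 hab hac hbc haa hab' hac' hbb hba' hbc'
  have hacp := hGb.adj_of_bull_s19 hac hab hbc.symm haa hac' hab' hcc hca' hcb'
  have hbcp := hGb.adj_of_bull_s19 hbc hab.symm hac.symm hbb hbc' hba' hcc hcb' hca'
  have hcd := hGd.adj_of_diamond_s19 (ne_lev hc' hd) habp hacp.symm hbcp.symm had.symm hbd.symm
  exact hac' (hGd.adj_of_diamond_s19 (ne_lev ha' hc) hcd hacp had hcc.symm hdc.symm)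
end
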